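/- (S-resolvent equation, first form.) Let V be a two-sided quaternionic Banach space, T ∈ B(V), and let s, p ∈ ρ_S(T) with p ∉ [s]. Then S_R⁻¹(s,T) ∘ S_L⁻¹(p,T) = [ (S_R⁻¹(s,T) − S_L⁻¹(p,T))·p − s̄·(S_R⁻¹(s,T) − S_L⁻¹(p,T)) ] · (p² − 2(Re s)p + ‖s‖²)⁻¹, where the quaternion p² − 2(Re s)p + ‖s‖² is nonzero since p ∉ [s] and its inverse acts on operators via B·q := B ∘ L_q. -/

import Mathlib

noncomputable section
notation "ℍ" => Quaternion ℝ

/-- The 2-sphere `[s]` of a quaternion `s`. -/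
def sphereOf (s : ℍ) : Set ℍ := {p | p.re = s.re ∧ ‖p‖ = ‖s‖}

variable {V : Type*} [NormedAddCommGroup V] [CompleteSpace V]
  [Module ℍ V] [Module ℍᵐᵒᵖ V] [SMulCommClass ℍ ℍᵐᵒᵖ V] [ContinuousConstSMul ℍ V]

/-- Left multiplication by a quaternion `q`, as a continuous right-linear
(i.e. `ℍᵐᵒᵖ`-linear) operator. -/
def Lmul (q : ℍ) : V →L[ℍᵐᵒᵖ] V :=
  { toFun := fun v => q • v
    map_add' := fun a b => smul_add q a b
    map_smul' := fun m v => smul_comm q m v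
    cont := continuous_const_smul q }

/-- The pseudo-resolvent second-order operator `𝒬_s(T) = T² − 2(Re s)·T + ‖s‖²·I`. -/
def QOp (T : V →L[ℍᵐᵒᵖ] V) (s : ℍ) : V →L[ℍᵐᵒᵖ] V :=
  T ∘L T - Lmul ((2 * s.re : ℝ) : ℍ) ∘L T + Lmul ((‖s‖ ^ 2 : ℝ) : ℍ)

/-- The left S-resolvent operator `S_L⁻¹(s,T) = −𝒬_s(T)⁻¹ ∘ (T − s̄ I)`. -/
def SLres (T : V →L[ℍᵐᵒᵖ] V) (s : ℍ) : V →L[ℍᵐᵒᵖ] V :=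
  -(Ring.inverse (QOp T s) ∘L (T - Lmul (star s)))

/-- The right S-resolvent operator `S_R⁻¹(s,T) = −(T − s̄ I) ∘ 𝒬_s(T)⁻¹`. -/
def SRres (T : V →L[ℍᵐᵒᵖ] V) (s : ℍ) : V →L[ℍᵐᵒᵖ] V :=
  -((T - Lmul (star s)) ∘L Ring.inverse (QOp T s))

section Ring

variable {R : Type*} [Ring R]

theorem left_resolvent_identity {T B p p' : R} (hB : B * T = T * B)
    (hc : (p + p') * T = T * (p + p')) (h : B * (T * T - (p + p') * T + p' * p) = 1) :
    -(B * (T - p')) * p = 1 + T * -(B * (T - p')) := by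
  rw [mul_neg, ← mul_assoc, ← hB, ← h, hc]
  noncomm_ring

theorem right_resolvent_identity {T A s s' : R} (hA : A * T = T * A)
    (h : (T * T - (s + s') * T + s * s') * A = 1) :
    -((T - s') * A) * T = s * -((T - s') * A) - 1 := by
  rw [neg_mul, mul_assoc, hA, ← h]
  noncomm_ring

theorem resolvent_equation {T p s s' n X Y : R}
    (hX : X * T = s * X - 1) (hY : Y * p = 1 + T * Y)
    (hQ : X * (T * T - (s + s') * T + n) = -(T - s'))
    (hcX : X * (s + s') = (s + s') * X) (hcY : Y * (s + s') = (s + s') * Y)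
    (hnY : Y * n = n * Y) :
    X * Y * (p * p - (s + s') * p + n) = (X - Y) * p - s' * (X - Y) := by
  have hD : Y * (p * p - (s + s') * p + n) =
      p + T - (s + s') + (T * T - (s + s') * T + n) * Y := by
    rw [mul_add, mul_sub, ← mul_assoc, ← mul_assoc, hcY, hnY, mul_assoc _ Y, hY, add_mul,
      mul_assoc T, hY]
    noncomm_ring
  rw [mul_assoc, hD, mul_add, ← mul_assoc, hQ, mul_sub, mul_add, hX, hcX, sub_mul, hY]
  noncomm_ring

end Ring

theorem map_coe_real_smul (hnorml : ∀ (q : ℍ) (v : V), ‖q • v‖ = ‖q‖ * ‖v‖)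
    (T : V →L[ℍᵐᵒᵖ] V) (r : ℝ) (v : V) : T ((r : ℍ) • v) = (r : ℍ) • T v := by
  let _ : Module ℝ V := Module.compHom V (algebraMap ℝ ℍ)
  let _ : NormedSpace ℝ V :=
    ⟨fun r v => ((hnorml (r : ℍ) v).trans (by rw [Quaternion.norm_coe])).le⟩
  exact map_real_smul T T.continuous r v

theorem Lmul_mul (a b : ℍ) : (Lmul (a * b) : V →L[ℍᵐᵒᵖ] V) = Lmul a * Lmul b :=
  ContinuousLinearMap.ext fun v => mul_smul a b v

theorem Lmul_add (a b : ℍ) : (Lmul (a + b) : V →L[ℍᵐᵒᵖ] V) = Lmul a + Lmul b :=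
  ContinuousLinearMap.ext fun v => add_smul a b v

theorem Lmul_sub (a b : ℍ) : (Lmul (a - b) : V →L[ℍᵐᵒᵖ] V) = Lmul a - Lmul b := by
  rw [eq_sub_iff_add_eq, ← Lmul_add, sub_add_cancel]

theorem Lmul_one : (Lmul 1 : V →L[ℍᵐᵒᵖ] V) = 1 :=
  ContinuousLinearMap.ext fun v => one_smul ℍ v

theorem Lmul_real_commute (hnorml : ∀ (q : ℍ) (v : V), ‖q • v‖ = ‖q‖ * ‖v‖)
    (T : V →L[ℍᵐᵒᵖ] V) (r : ℝ) : Commute (Lmul (r : ℍ)) T :=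
  ContinuousLinearMap.ext fun v => (map_coe_real_smul hnorml T r v).symm

theorem QOp_eq (T : V →L[ℍᵐᵒᵖ] V) (s : ℍ) :
    QOp T s = T * T - Lmul ((2 * s.re : ℝ) : ℍ) * T + Lmul ((‖s‖ ^ 2 : ℝ) : ℍ) := rfl

theorem QOp_commute (hnorml : ∀ (q : ℍ) (v : V), ‖q • v‖ = ‖q‖ * ‖v‖)
    (T : V →L[ℍᵐᵒᵖ] V) (s : ℍ) : Commute (QOp T s) T :=
  (((Commute.refl T).mul_left (Commute.refl T)).sub_left
    ((Lmul_real_commute hnorml T _).mul_left (Commute.refl T))).add_left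
    (Lmul_real_commute hnorml T _)

theorem coe_two_re (s : ℍ) : ((2 * s.re : ℝ) : ℍ) = s + star s := by
  rw [Quaternion.self_add_star']

theorem coe_norm_sq (s : ℍ) : ((‖s‖ ^ 2 : ℝ) : ℍ) = star s * s := by
  rw [Quaternion.star_mul_self, Quaternion.normSq_eq_norm_mul_self, pow_two]

theorem coe_norm_sq' (s : ℍ) : ((‖s‖ ^ 2 : ℝ) : ℍ) = s * star s := by
  rw [Quaternion.self_mul_star, Quaternion.normSq_eq_norm_mul_self, pow_two]

theorem inverse_QOp_commute (hnorml : ∀ (q : ℍ) (v : V), ‖q • v‖ = ‖q‖ * ‖v‖)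
    (T : V →L[ℍᵐᵒᵖ] V) {s : ℍ} (hs : IsUnit (QOp T s)) :
    Commute (Ring.inverse (QOp T s)) T := by
  have h := QOp_commute hnorml T s
  obtain ⟨u, hu⟩ := hs
  rw [← hu] at h ⊢
  rw [Ring.inverse_unit]
  exact h.units_inv_left

/-- The left S-resolvent satisfies `S_L⁻¹(p,T) p = I + T S_L⁻¹(p,T)`. -/
theorem SLres_mul_Lmul (hnorml : ∀ (q : ℍ) (v : V), ‖q • v‖ = ‖q‖ * ‖v‖)
    (T : V →L[ℍᵐᵒᵖ] V) {p : ℍ} (hp : IsUnit (QOp T p)) :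
    SLres T p * Lmul p = 1 + T * SLres T p := by
  have hc := (Lmul_real_commute hnorml T (2 * p.re)).eq
  have h := Ring.inverse_mul_cancel _ hp
  rw [coe_two_re, Lmul_add] at hc
  nth_rw 2 [QOp_eq] at h
  rw [coe_two_re, coe_norm_sq, Lmul_mul, Lmul_add] at h
  exact left_resolvent_identity (inverse_QOp_commute hnorml T hp).eq hc h

/-- The right S-resolvent satisfies `S_R⁻¹(s,T) T = s S_R⁻¹(s,T) - I`. -/
theorem SRres_mul_self (hnorml : ∀ (q : ℍ) (v : V), ‖q • v‖ = ‖q‖ * ‖v‖)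
    (T : V →L[ℍᵐᵒᵖ] V) {s : ℍ} (hs : IsUnit (QOp T s)) :
    SRres T s * T = Lmul s * SRres T s - 1 := by
  have h := Ring.mul_inverse_cancel _ hs
  nth_rw 1 [QOp_eq] at h
  rw [coe_two_re, coe_norm_sq', Lmul_mul, Lmul_add] at h
  exact right_resolvent_identity (inverse_QOp_commute hnorml T hs).eq h

theorem SRres_mul_QOp (T : V →L[ℍᵐᵒᵖ] V) {s : ℍ} (hs : IsUnit (QOp T s)) :
    SRres T s * QOp T s = -(T - Lmul (star s)) :=
  (neg_mul _ _).trans (congrArg Neg.neg (Ring.inverse_mul_cancel_right _ _ hs))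

theorem companion_ne_zero {s p : ℍ} (hps : p ∉ sphereOf s) :
    p ^ 2 - 2 * (s.re : ℍ) * p + ((‖s‖ ^ 2 : ℝ) : ℍ) ≠ 0 := by
  intro h
  have hcast : (2 : ℍ) * (s.re : ℍ) = ((2 * s.re : ℝ) : ℍ) := by push_cast; rfl
  have hns := Quaternion.normSq_eq_norm_mul_self s
  have hnp := Quaternion.normSq_eq_norm_mul_self p
  rw [hcast, pow_two p, pow_two ‖s‖, ← hns, Quaternion.ext_iff] at h
  simp only [Quaternion.re_add, Quaternion.re_sub, Quaternion.re_mul, Quaternion.re_coe,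
    Quaternion.imI_add, Quaternion.imI_sub, Quaternion.imI_mul, Quaternion.imI_coe,
    Quaternion.imJ_add, Quaternion.imJ_sub, Quaternion.imJ_mul, Quaternion.imJ_coe,
    Quaternion.imK_add, Quaternion.imK_sub, Quaternion.imK_mul, Quaternion.imK_coe,
    Quaternion.re_zero, Quaternion.imI_zero, Quaternion.imJ_zero, Quaternion.imK_zero,
    Quaternion.normSq_def'] at h
  rw [Quaternion.normSq_def'] at hns hnp
  obtain ⟨h0, h1, h2, h3⟩ := h
  have key : p.re = s.re := by
    by_contra hne
    have hd : p.re - s.re ≠ 0 := sub_ne_zero.mpr hne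
    have e1 : p.imI = 0 := mul_left_cancel₀ hd (by linarith)
    have e2 : p.imJ = 0 := mul_left_cancel₀ hd (by linarith)
    have e3 : p.imK = 0 := mul_left_cancel₀ hd (by linarith)
    rw [e1, e2, e3] at h0
    have := pow_pos (abs_pos.mpr hd) 2
    rw [sq_abs] at this
    nlinarith [sq_nonneg s.imI, sq_nonneg s.imJ, sq_nonneg s.imK]
  refine hps ⟨key, ?_⟩
  rw [← sq_eq_sq₀ (norm_nonneg _) (norm_nonneg _), pow_two, pow_two, ← hns, ← hnp]
  rw [key] at h0 ⊢
  linarith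

/-- The S-resolvent equation (first form). -/
theorem sResolvent_equation_first (T : V →L[ℍᵐᵒᵖ] V)
    (hnorml : ∀ (q : ℍ) (v : V), ‖q • v‖ = ‖q‖ * ‖v‖)
    (hnormr : ∀ (q : ℍᵐᵒᵖ) (v : V), ‖q • v‖ = ‖q‖ * ‖v‖)
    (s p : ℍ) (hs : IsUnit (QOp T s)) (hp : IsUnit (QOp T p))
    (hps : p ∉ sphereOf s) :
    SRres T s ∘L SLres T p =
      ((SRres T s - SLres T p) ∘L Lmul p - Lmul (star s) ∘L (SRres T s - SLres T p)) ∘L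
        Lmul (p ^ 2 - 2 * (s.re : ℍ) * p + ((‖s‖ ^ 2 : ℝ) : ℍ))⁻¹ := by
  set q := p ^ 2 - 2 * (s.re : ℍ) * p + ((‖s‖ ^ 2 : ℝ) : ℍ) with hq
  have hqi : (Lmul q * Lmul q⁻¹ : V →L[ℍᵐᵒᵖ] V) = 1 := by
    rw [← Lmul_mul, mul_inv_cancel₀ (companion_ne_zero hps), Lmul_one]
  have hcast : (2 : ℍ) * (s.re : ℍ) = ((2 * s.re : ℝ) : ℍ) := by push_cast; rfl
  have hc (r : ℝ) (X : V →L[ℍᵐᵒᵖ] V) : X * Lmul (r : ℍ) = Lmul (r : ℍ) * X :=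
    (Lmul_real_commute hnorml X r).eq.symm
  have main : SRres T s * SLres T p * Lmul q =
      (SRres T s - SLres T p) * Lmul p - Lmul (star s) * (SRres T s - SLres T p) := by
    have hQ := SRres_mul_QOp T hs
    have hcX := hc (2 * s.re) (SRres T s)
    have hcY := hc (2 * s.re) (SLres T p)
    rw [QOp_eq, coe_two_re, Lmul_add] at hQ
    rw [coe_two_re, Lmul_add] at hcX hcY
    rw [hq, hcast, coe_two_re, pow_two p, Lmul_add, Lmul_sub, Lmul_mul, Lmul_mul, Lmul_add]
    exact resolvent_equation (SRres_mul_self hnorml T hs) (SLres_mul_Lmul hnorml T hp) hQ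
      hcX hcY (hc _ _)
  change SRres T s * SLres T p =
    ((SRres T s - SLres T p) * Lmul p - Lmul (star s) * (SRres T s - SLres T p)) * Lmul q⁻¹
  rw [← main, mul_assoc _ (Lmul q), hqi, mul_one]
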